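/- A balanced line bundle L on a quasistable curve C of genus g ≥ 2 is stably balanced if and only if it is strictly balanced and the non-exceptional subcurve C̃ is connected. -/

import Mathlib

open Finset

/-- A combinatorial model of a nodal curve `C` over `ℂ` together with the multidegree
of a line bundle `L` on `C`.

`ι` indexes the irreducible components of `C` and `Node` its nodes; a node `n` has two
branches, lying on the components `branch1 n` and `branch2 n` (which coincide exactly
when `n` is a self-node of an irreducible component).  `compGenus i` is the geometric
genus of the `i`-th component and `degL i` is the degree of `L` on it. -/
structure NodalCurveBundle where
  /-- the irreducible components of `C` -/
  ι : Type
  [fintypeι : Fintype ι]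
  [decEqι : DecidableEq ι]
  [nonemptyι : Nonempty ι]
  /-- the nodes of `C` -/
  Node : Type
  [fintypeNode : Fintype Node]
  [decEqNode : DecidableEq Node]
  /-- the component containing the first branch of a node -/
  branch1 : Node → ι
  /-- the component containing the second branch of a node -/
  branch2 : Node → ι
  /-- the geometric genus of each component -/
  compGenus : ι → ℕ
  /-- the degree of the line bundle `L` on each component -/
  degL : ι → ℤ

attribute [instance] NodalCurveBundle.fintypeι NodalCurveBundle.decEqι
  NodalCurveBundle.nonemptyι NodalCurveBundle.fintypeNode NodalCurveBundle.decEqNode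

namespace NodalCurveBundle

variable (Q : NodalCurveBundle)

/-- The number of branches of nodes of `C` lying on the component `i` (a self-node
counts twice). -/
def valence (i : Q.ι) : ℕ :=
  (univ.filter fun n => Q.branch1 n = i).card +
    (univ.filter fun n => Q.branch2 n = i).card

/-- The component `i` is an exceptional component: it is smooth rational and meets the
closure of the rest of the curve in exactly two points. -/
def IsExceptional (i : Q.ι) : Prop :=
  Q.compGenus i = 0 ∧ Q.valence i = 2 ∧ ∀ n, ¬(Q.branch1 n = i ∧ Q.branch2 n = i)

/-- Two components are adjacent when some node of `C` joins them. -/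
def Adj (a b : Q.ι) : Prop :=
  ∃ n, (Q.branch1 n = a ∧ Q.branch2 n = b) ∨ (Q.branch1 n = b ∧ Q.branch2 n = a)

/-- The curve `C` is connected. -/
def Connected : Prop := ∀ a b : Q.ι, Relation.ReflTransGen Q.Adj a b

/-- The arithmetic genus of `C`. -/
def genus : ℤ :=
  (∑ i, (Q.compGenus i : ℤ)) + (Fintype.card Q.Node : ℤ) - (Fintype.card Q.ι : ℤ) + 1

/-- The total degree `d` of the line bundle `L`. -/
def deg : ℤ := ∑ i, Q.degL i

/-- `C` is quasistable: it is connected, Deligne–Mumford semistable (every smooth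
rational component meets the rest of the curve in at least two points) and its
exceptional components are pairwise disjoint. -/
def IsQuasistable : Prop :=
  Q.Connected ∧ (∀ i, Q.compGenus i = 0 → 2 ≤ Q.valence i) ∧
    ∀ n, ¬(Q.IsExceptional (Q.branch1 n) ∧ Q.IsExceptional (Q.branch2 n))

/-- The degree of `L` on the subcurve whose components are `Z`. -/
def degLsub (Z : Finset Q.ι) : ℤ := ∑ i ∈ Z, Q.degL i

/-- The degree of the restriction `ω_C|_Z` of the dualizing sheaf `ω_C` to the subcurve
whose components are `Z`. -/
def degOmega (Z : Finset Q.ι) : ℤ :=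
  ∑ i ∈ Z, (2 * (Q.compGenus i : ℤ) - 2 + (Q.valence i : ℤ))

/-- `n` is one of the points where the subcurve `Z` meets the complementary subcurve
`Z^c`. -/
def SepNode (Z : Finset Q.ι) (n : Q.Node) : Prop :=
  (Q.branch1 n ∈ Z ∧ Q.branch2 n ∉ Z) ∨ (Q.branch1 n ∉ Z ∧ Q.branch2 n ∈ Z)

instance (Z : Finset Q.ι) : DecidablePred (Q.SepNode Z) := fun n => by
  unfold SepNode; infer_instance

/-- `k_Z` : the number of intersection points of the subcurve `Z` with the
complementary subcurve `Z^c`. -/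
def kZ (Z : Finset Q.ι) : ℕ := (univ.filter fun n => Q.SepNode Z n).card

/-- The basic inequality for `L` on the subcurve `Z`:
`|deg_Z L - d · deg_Z(ω_C|_Z) / (2g - 2)| ≤ k_Z / 2`. -/
def BasicIneq (Z : Finset Q.ι) : Prop :=
  |(Q.degLsub Z : ℚ) - (Q.deg : ℚ) * (Q.degOmega Z : ℚ) / (2 * (Q.genus : ℚ) - 2)| ≤
    (Q.kZ Z : ℚ) / 2

/-- Equality holds in (one of the two inequalities of) the basic inequality for `L` on
the subcurve `Z`. -/
def BasicEq (Z : Finset Q.ι) : Prop :=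
  |(Q.degLsub Z : ℚ) - (Q.deg : ℚ) * (Q.degOmega Z : ℚ) / (2 * (Q.genus : ℚ) - 2)| =
    (Q.kZ Z : ℚ) / 2

/-- `L` is balanced: it has degree `1` on every exceptional component and the basic
inequality holds for every subcurve. -/
def Balanced : Prop :=
  (∀ i, Q.IsExceptional i → Q.degL i = 1) ∧
    ∀ Z : Finset Q.ι, Z.Nonempty → Q.BasicIneq Z

/-- `L` is strictly balanced: it is balanced and, for every proper subcurve `Z`
attaining equality in the basic inequality, the intersection `Z ∩ Z^c` is contained in
the exceptional subcurve `C_exc`. -/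
def StrictlyBalanced : Prop :=
  Q.Balanced ∧
    ∀ Z : Finset Q.ι, Z.Nonempty → Z ≠ univ → Q.BasicEq Z →
      ∀ n, Q.SepNode Z n →
        Q.IsExceptional (Q.branch1 n) ∨ Q.IsExceptional (Q.branch2 n)

/-- `L` is stably balanced: it is balanced and, for every proper subcurve `Z` attaining
equality in the basic inequality, either `Z` or `Z^c` is entirely contained in the
exceptional subcurve `C_exc`. -/
def StablyBalanced : Prop :=
  Q.Balanced ∧
    ∀ Z : Finset Q.ι, Z.Nonempty → Z ≠ univ → Q.BasicEq Z →
      (∀ i ∈ Z, Q.IsExceptional i) ∨ (∀ i ∉ Z, Q.IsExceptional i)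

/-- The non-exceptional subcurve `C̃` (the closure of the complement of the exceptional
components) is connected: it is nonempty and any two non-exceptional components are
joined by a chain of non-exceptional components meeting at nodes. -/
def TildeConnected : Prop :=
  (∃ i, ¬Q.IsExceptional i) ∧
    ∀ a b : Q.ι, ¬Q.IsExceptional a → ¬Q.IsExceptional b →
      Relation.ReflTransGen
        (fun x y => ¬Q.IsExceptional x ∧ ¬Q.IsExceptional y ∧ Q.Adj x y) a b

end NodalCurveBundle

namespace NodalCurveBundle

theorem sum_valence (Q : NodalCurveBundle) (S : Finset Q.ι) :
    ∑ i ∈ S, Q.valence i =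
      ∑ n, ((if Q.branch1 n ∈ S then 1 else 0) + (if Q.branch2 n ∈ S then 1 else 0)) := by
  simp only [valence, card_filter, sum_add_distrib]
  congr 1 <;> rw [sum_comm] <;> simp

theorem degOmega_univ (Q : NodalCurveBundle) : Q.degOmega univ = 2 * Q.genus - 2 := by
  have h : ∑ i, (Q.valence i : ℤ) = 2 * Fintype.card Q.Node := by
    have h' := Q.sum_valence univ
    simp only [mem_univ, if_true, sum_const, card_univ, smul_eq_mul] at h'
    push_cast [← Nat.cast_sum, h']
    ring
  simp only [degOmega, genus, sum_add_distrib, sum_sub_distrib, h, ← mul_sum, sum_const,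
    card_univ, nsmul_eq_mul]
  ring

theorem degOmega_eq_zero (Q : NodalCurveBundle) {S : Finset Q.ι}
    (hS : ∀ i ∈ S, Q.IsExceptional i) : Q.degOmega S = 0 :=
  sum_eq_zero fun i hi => by
    obtain ⟨h0, h2, -⟩ := hS i hi
    simp [h0, h2]

theorem exists_not_isExceptional (Q : NodalCurveBundle) (hg : 2 ≤ Q.genus) :
    ∃ i, ¬Q.IsExceptional i := by
  by_contra! h
  have h1 := Q.degOmega_univ
  rw [Q.degOmega_eq_zero fun i _ => h i] at h1
  omega

/-- If removing a set `E` of exceptional components from `Z` leaves few enough separating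
nodes, then a balanced line bundle attains equality in the basic inequality on `Z`. -/
theorem Balanced.basicEq_of_kZ_add_kZ_sdiff_le {Q : NodalCurveBundle} (hL : Q.Balanced)
    {Z E : Finset Q.ι} (hEZ : E ⊆ Z) (hE : ∀ i ∈ E, Q.IsExceptional i)
    (hZ : (Z \ E).Nonempty) (hk : Q.kZ Z + Q.kZ (Z \ E) ≤ 2 * E.card) : Q.BasicEq Z := by
  have h1 := hL.2 Z (hZ.mono sdiff_subset)
  have h2 := hL.2 (Z \ E) hZ
  have hω : Q.degOmega Z = Q.degOmega (Z \ E) := by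
    have h := sum_sdiff (f := fun i => 2 * (Q.compGenus i : ℤ) - 2 + (Q.valence i : ℤ)) hEZ
    have h0 := Q.degOmega_eq_zero hE
    unfold degOmega at *
    omega
  have hd : Q.degLsub Z = Q.degLsub (Z \ E) + E.card := by
    have h := sum_sdiff (f := Q.degL) hEZ
    rw [sum_congr (s₁ := E) rfl fun i hi => hL.1 i (hE i hi)] at h
    simp only [sum_const, nsmul_eq_mul, mul_one] at h
    exact h.symm
  have hk' : (Q.kZ Z : ℚ) + Q.kZ (Z \ E) ≤ 2 * E.card := by exact_mod_cast hk
  unfold BasicIneq at h1 h2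
  unfold BasicEq
  rw [hω, hd] at h1 ⊢
  push_cast at h1 ⊢
  refine le_antisymm h1 (le_trans ?_ (le_abs_self _))
  have := (abs_le.mp h2).1
  linarith

/-- A subset `Y` of the non-exceptional components which is a union of connected components
of `C̃` lies in a subcurve `Z`, meeting the non-exceptional components exactly in `Y`, on
which equality holds in the basic inequality. -/
theorem Balanced.exists_basicEq {Q : NodalCurveBundle} (hQ : Q.IsQuasistable)
    (hL : Q.Balanced) {Y : Q.ι → Prop} (hne : ∃ i, Y i)
    (hY : ∀ i, Y i → ¬Q.IsExceptional i)
    (hclosed : ∀ i j, Y i → ¬Q.IsExceptional j → Q.Adj i j → Y j) :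
    ∃ Z : Finset Q.ι, (∀ i, ¬Q.IsExceptional i → (i ∈ Z ↔ Y i)) ∧ Q.BasicEq Z := by
  classical
  set Z : Finset Q.ι :=
    univ.filter fun i => Y i ∨ (Q.IsExceptional i ∧ ∃ j, Y j ∧ Q.Adj i j) with hZ
  set E : Finset Q.ι :=
    Z.filter fun i => Q.IsExceptional i ∧ ∃ j, ¬Y j ∧ Q.Adj i j with hE
  have hEexc : ∀ i ∈ E, Q.IsExceptional i := fun i hi => (mem_filter.mp hi).2.1
  have hmem : ∀ i, ¬Q.IsExceptional i → (i ∈ Z ↔ Y i) := fun i hi => by simp [hZ, hi]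
  refine ⟨Z, hmem, hL.basicEq_of_kZ_add_kZ_sdiff_le (E := E) (filter_subset _ _) hEexc ?_ ?_⟩
  · obtain ⟨i, hi⟩ := hne
    exact ⟨i, mem_sdiff.mpr ⟨(hmem i (hY i hi)).mpr hi, fun h => hY i hi (hEexc i h)⟩⟩
  have hval : 2 * E.card = ∑ i ∈ E, Q.valence i := by
    rw [sum_congr rfl fun i hi => (hEexc i hi).2.1]
    simp [mul_comm]
  rw [hval, sum_valence, kZ, kZ, card_filter, card_filter, ← sum_add_distrib]
  refine sum_le_sum fun n _ => ?_
  have ha : Q.Adj (Q.branch1 n) (Q.branch2 n) := ⟨n, Or.inl ⟨rfl, rfl⟩⟩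
  have hb : Q.Adj (Q.branch2 n) (Q.branch1 n) := ⟨n, Or.inr ⟨rfl, rfl⟩⟩
  have hdisj := hQ.2.2 n
  have key : ∀ x y, Q.Adj x y → Q.IsExceptional x → ¬Q.IsExceptional y →
      (y ∈ Z → x ∈ Z) ∧ (x ∈ Z → y ∉ Z → x ∈ E) := by
    intro x y hxy hx hy
    rw [hmem y hy]
    exact ⟨fun h => mem_filter.mpr ⟨mem_univ x, Or.inr ⟨hx, y, h, hxy⟩⟩,
      fun h hn => mem_filter.mpr ⟨h, hx, y, hn, hxy⟩⟩
  have k1 := key _ _ ha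
  have k2 := key _ _ hb
  have m1 := hmem (Q.branch1 n)
  have m2 := hmem (Q.branch2 n)
  have c1 := fun h h' => hclosed _ _ h h' ha
  have c2 := fun h h' => hclosed _ _ h h' hb
  have e1 := hEexc (Q.branch1 n)
  have e2 := hEexc (Q.branch2 n)
  clear_value E Z
  simp only [SepNode, mem_sdiff]
  clear hZ hE key hmem hEexc hval hclosed hY hne
  by_cases hxu : Q.IsExceptional (Q.branch1 n) <;>
    by_cases hxv : Q.IsExceptional (Q.branch2 n)
  · exact absurd ⟨hxu, hxv⟩ hdisj
  · have hv : Q.branch2 n ∉ E := fun h => hxv (e2 h)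
    have := k1 hxu hxv
    by_cases hvZ : Q.branch2 n ∈ Z <;> by_cases huZ : Q.branch1 n ∈ Z <;>
      by_cases huE : Q.branch1 n ∈ E <;> simp_all
  · have hu : Q.branch1 n ∉ E := fun h => hxu (e1 h)
    have := k2 hxv hxu
    by_cases hvZ : Q.branch2 n ∈ Z <;> by_cases huZ : Q.branch1 n ∈ Z <;>
      by_cases hvE : Q.branch2 n ∈ E <;> simp_all
  · have hu : Q.branch1 n ∉ E := fun h => hxu (e1 h)
    have hv : Q.branch2 n ∉ E := fun h => hxv (e2 h)
    have huv : Q.branch1 n ∈ Z ↔ Q.branch2 n ∈ Z := by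
      rw [m1 hxu, m2 hxv]
      exact ⟨fun h => c1 h hxv, fun h => c2 h hxu⟩
    by_cases hvZ : Q.branch2 n ∈ Z <;> simp [hu, hv, huv, hvZ]

/-- A chain that starts inside a set and ends outside it has a step leaving the set. -/
theorem exists_step_of_reflTransGen {α : Type*} {r : α → α → Prop} {s : α → Prop} {a b : α}
    (h : Relation.ReflTransGen r a b) (ha : s a) (hb : ¬s b) :
    ∃ x y, r x y ∧ s x ∧ ¬s y := by
  induction h with
  | refl => exact absurd ha hb
  | @tail c d _ hcd ih =>
    by_cases hc : s c
    · exact ⟨c, d, hcd, hc, hb⟩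
    · exact ih hc

theorem StablyBalanced.strictlyBalanced {Q : NodalCurveBundle} (h : Q.StablyBalanced) :
    Q.StrictlyBalanced := by
  refine ⟨h.1, fun Z hne hun heq n hn => ?_⟩
  rcases h.2 Z hne hun heq with hZ | hZ <;> rcases hn with ⟨h1, h2⟩ | ⟨h1, h2⟩
  · exact Or.inl (hZ _ h1)
  · exact Or.inr (hZ _ h2)
  · exact Or.inr (hZ _ h2)
  · exact Or.inl (hZ _ h1)

theorem StablyBalanced.tildeConnected {Q : NodalCurveBundle} (hQ : Q.IsQuasistable)
    (hg : 2 ≤ Q.genus) (h : Q.StablyBalanced) : Q.TildeConnected := by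
  refine ⟨Q.exists_not_isExceptional hg, fun a b ha hb => ?_⟩
  by_contra hab
  obtain ⟨Z, hZ, heq⟩ := h.1.exists_basicEq hQ
    (Y := fun i => ¬Q.IsExceptional i ∧ Relation.ReflTransGen
      (fun x y => ¬Q.IsExceptional x ∧ ¬Q.IsExceptional y ∧ Q.Adj x y) a i)
    ⟨a, ha, .refl⟩ (fun i hi => hi.1)
    (fun i j hi hj hij => ⟨hj, hi.2.tail ⟨hi.1, hj, hij⟩⟩)
  have haZ : a ∈ Z := (hZ a ha).mpr ⟨ha, .refl⟩
  have hbZ : b ∉ Z := fun hb' => hab ((hZ b hb).mp hb').2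
  rcases h.2 Z ⟨a, haZ⟩ (fun hu => hbZ (hu ▸ mem_univ b)) heq with hexc | hexc
  · exact ha (hexc a haZ)
  · exact hb (hexc b hbZ)

theorem StrictlyBalanced.stablyBalanced {Q : NodalCurveBundle} (h : Q.StrictlyBalanced)
    (hC : Q.TildeConnected) : Q.StablyBalanced := by
  refine ⟨h.1, fun Z hne hun heq => ?_⟩
  by_contra! hcon
  obtain ⟨⟨a, haZ, ha⟩, b, hbZ, hb⟩ := hcon
  obtain ⟨x, y, ⟨hx, hy, n, hn⟩, hxZ, hyZ⟩ :=
    exists_step_of_reflTransGen (s := (· ∈ Z)) (hC.2 a b ha hb) haZ hbZ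
  rcases hn with ⟨rfl, rfl⟩ | ⟨rfl, rfl⟩
  · exact (h.2 Z hne hun heq n (Or.inl ⟨hxZ, hyZ⟩)).elim hx hy
  · exact (h.2 Z hne hun heq n (Or.inr ⟨hyZ, hxZ⟩)).elim hy hx

end NodalCurveBundle

/-- **Stably balanced = strictly balanced + connected non-exceptional subcurve**
(Lemma 2.5 of Bini–Fontanari–Viviani): a balanced line bundle `L` on a quasistable
curve `C` of genus `g ≥ 2` is stably balanced if and only if it is strictly balanced
and the non-exceptional subcurve `C̃` is connected. -/
theorem stablyBalanced_iff (Q : NodalCurveBundle)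
    (hQ : Q.IsQuasistable) (hg : 2 ≤ Q.genus) (hL : Q.Balanced) :
    Q.StablyBalanced ↔ Q.StrictlyBalanced ∧ Q.TildeConnected :=
  ⟨fun h => ⟨h.strictlyBalanced, h.tildeConnected hQ hg⟩, fun h => h.1.stablyBalanced h.2⟩
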